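/- arXiv:1509.01456 — 2 statements merged into one kernel-verified Lean document; each statement's English description precedes it below -/
import Mathlib

section
/- Suppose u is a fuzzy number and w ∈ F_D(ℝ), and suppose w satisfies: (i) w(w⁻(0)) = u(u⁻(0)) and w(w⁺(0)) = u(u⁺(0)); (ii-1) if u⁻(1) is an interior point of [u]_0 at which u is not differentiable, then w'₋(w⁻(1)) = 0; (ii-2) if u⁺(1) is an interior point of [u]_0 at which u is not differentiable, then w'₊(w⁺(1)) = 0; (iv) for every point x ∈ (u⁻(0), u⁺(0)) at which u is not differentiable: if u⁻(0) < x < u⁻(1) then w'₊(w⁻(u(x))) = 0, and if u⁺(1) < x < u⁺(0) then w'₋(w⁺(u(x))) = 0; and (v) for every x with u⁻(0) < x ≤ u⁻(1) at which u is not left-continuous, w'₊(w⁻(β)) = 0 where β = lim_{y→x⁻} u(y), and for every x with u⁺(1) ≤ x < u⁺(0) at which u is not right-continuous, w'₋(w⁺(γ)) = 0 where γ = lim_{y→x⁺} u(y). Then u∇w ∈ F_D(ℝ). -/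
open Set Filter Topology

/-- A fuzzy number: a function `ℝ → ℝ` taking values in `[0,1]`, whose `α`-cuts
(for `α ∈ (0,1]`) and whose `0`-cut (the closure of the support) are nonempty
compact intervals. -/
structure FuzzyNumber where
  f : ℝ → ℝ
  mem_Icc : ∀ x, f x ∈ Set.Icc (0 : ℝ) 1
  cut_isIcc : ∀ α ∈ Set.Ioc (0 : ℝ) 1, ∃ a b : ℝ, a ≤ b ∧ {x | α ≤ f x} = Set.Icc a b
  supp_isIcc : ∃ a b : ℝ, a ≤ b ∧ closure {x | 0 < f x} = Set.Icc a b

namespace FuzzyNumber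

/-- The `α`-cut of a fuzzy number; for `α = 0` it is the closure of the support. -/
noncomputable def cut (u : FuzzyNumber) (α : ℝ) : Set ℝ :=
  if α = 0 then closure {x | 0 < u.f x} else {x | α ≤ u.f x}

/-- Left endpoint `u⁻(α)` of the `α`-cut. -/
noncomputable def lo (u : FuzzyNumber) (α : ℝ) : ℝ := sInf (u.cut α)

/-- Right endpoint `u⁺(α)` of the `α`-cut. -/
noncomputable def hi (u : FuzzyNumber) (α : ℝ) : ℝ := sSup (u.cut α)

/-- Left endpoint `u_s⁻(α)` of the strong `α`-cut: `lim_{β→α⁺} u⁻(β)` for `α < 1`,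
and `u⁻(1)` for `α = 1`.  Since `u⁻` is nondecreasing, this right limit is the
infimum of `u⁻` over `(α,1]`. -/
noncomputable def slo (u : FuzzyNumber) (α : ℝ) : ℝ :=
  if α < 1 then sInf (u.lo '' Set.Ioc α 1) else u.lo 1

/-- Right endpoint `u_s⁺(α)` of the strong `α`-cut: `lim_{β→α⁺} u⁺(β)` for `α < 1`,
and `u⁺(1)` for `α = 1`. -/
noncomputable def shi (u : FuzzyNumber) (α : ℝ) : ℝ :=
  if α < 1 then sSup (u.hi '' Set.Ioc α 1) else u.hi 1

/-- The sup-min convolution `u∇v` of two fuzzy numbers, as a function on `ℝ`: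
`(u∇v)(x) = sup_y min (u y) (v (x - y))`.  Its cut functions satisfy
`(u∇v)⁻(α) = u⁻(α) + v⁻(α)` and `(u∇v)⁺(α) = u⁺(α) + v⁺(α)`. -/
noncomputable def conv (u v : FuzzyNumber) (x : ℝ) : ℝ :=
  ⨆ y : ℝ, min (u.f y) (v.f (x - y))

end FuzzyNumber

/-- `f` has left derivative `f'` at `x`. -/
def HasLeftDerivAt (f : ℝ → ℝ) (f' x : ℝ) : Prop :=
  HasDerivWithinAt f f' (Set.Iio x) x

/-- `f` has right derivative `f'` at `x`. -/
def HasRightDerivAt (f : ℝ → ℝ) (f' x : ℝ) : Prop :=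
  HasDerivWithinAt f f' (Set.Ioi x) x

namespace FuzzyNumber

section Basic

variable (u : FuzzyNumber)

lemma cut_zero_eq : closure {x | 0 < u.f x} = Icc (u.lo 0) (u.hi 0) ∧ u.lo 0 ≤ u.hi 0 := by
  obtain ⟨a, b, hab, h⟩ := u.supp_isIcc
  have hlo : u.lo 0 = a := by simp [lo, cut, h, csInf_Icc hab]
  have hhi : u.hi 0 = b := by simp [hi, cut, h, csSup_Icc hab]
  rw [hlo, hhi]
  exact ⟨h, hab⟩

lemma cut_eq {α : ℝ} (h0 : 0 < α) (h1 : α ≤ 1) :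
    {x | α ≤ u.f x} = Icc (u.lo α) (u.hi α) ∧ u.lo α ≤ u.hi α := by
  obtain ⟨a, b, hab, h⟩ := u.cut_isIcc α ⟨h0, h1⟩
  have hlo : u.lo α = a := by simp [lo, cut, h, h0.ne', csInf_Icc hab]
  have hhi : u.hi α = b := by simp [hi, cut, h, h0.ne', csSup_Icc hab]
  rw [hlo, hhi]
  exact ⟨h, hab⟩

lemma le_apply_iff {α : ℝ} (h0 : 0 < α) (h1 : α ≤ 1) (x : ℝ) :
    α ≤ u.f x ↔ u.lo α ≤ x ∧ x ≤ u.hi α :=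
  Set.ext_iff.1 (u.cut_eq h0 h1).1 x

lemma nonneg (x : ℝ) : 0 ≤ u.f x := (u.mem_Icc x).1

lemma le_one (x : ℝ) : u.f x ≤ 1 := (u.mem_Icc x).2

lemma mem_of_pos {x : ℝ} (h : 0 < u.f x) : x ∈ Icc (u.lo 0) (u.hi 0) :=
  u.cut_zero_eq.1 ▸ subset_closure h

lemma eq_zero_of_lt {x : ℝ} (h : x < u.lo 0) : u.f x = 0 := by
  by_contra hne
  exact absurd (u.mem_of_pos ((u.nonneg x).lt_of_ne' hne)).1 (not_le.2 h)

lemma apply_eq_one {x : ℝ} (hx : u.lo 1 ≤ x) (hx' : x ≤ u.hi 1) : u.f x = 1 :=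
  le_antisymm (u.le_one x) ((u.le_apply_iff one_pos le_rfl x).2 ⟨hx, hx'⟩)

lemma lo_one_le_hi_one : u.lo 1 ≤ u.hi 1 := (u.cut_eq one_pos le_rfl).2

lemma apply_lo_one : u.f (u.lo 1) = 1 := u.apply_eq_one le_rfl u.lo_one_le_hi_one

lemma lo_zero_le_lo_one : u.lo 0 ≤ u.lo 1 :=
  (u.mem_of_pos (by rw [u.apply_lo_one]; exact one_pos)).1

lemma hi_one_le_hi_zero : u.hi 1 ≤ u.hi 0 :=
  (u.mem_of_pos (by rw [u.apply_eq_one u.lo_one_le_hi_one le_rfl]; exact one_pos)).2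

lemma lo_one_le_of_apply {x : ℝ} (h : u.f x = 1) : u.lo 1 ≤ x :=
  ((u.le_apply_iff one_pos le_rfl x).1 h.ge).1

lemma le_hi_one_of_apply {x : ℝ} (h : u.f x = 1) : x ≤ u.hi 1 :=
  ((u.le_apply_iff one_pos le_rfl x).1 h.ge).2

lemma monotoneOn : MonotoneOn u.f (Iic (u.lo 1)) := by
  intro x _ y hy hxy
  rcases (u.nonneg x).eq_or_lt with h | h
  · rw [← h]; exact u.nonneg y
  · have hcut := u.le_apply_iff h (u.le_one x)
    exact (hcut y).2 ⟨((hcut x).1 le_rfl).1.trans hxy,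
      hy.trans ((hcut (u.lo 1)).1 (by rw [u.apply_lo_one]; exact u.le_one x)).2⟩

lemma mono {x y : ℝ} (hxy : x ≤ y) (hy : y ≤ u.lo 1) : u.f x ≤ u.f y :=
  u.monotoneOn (hxy.trans hy) hy hxy

lemma deriv_nonneg {p : ℝ} (hp : p < u.lo 1) : 0 ≤ deriv u.f p := by
  rw [← derivWithin_of_mem_nhds (Iic_mem_nhds hp)]
  exact u.monotoneOn.derivWithin_nonneg

lemma pos_of_lo_zero_lt {x : ℝ} (h : u.lo 0 < x) (h' : x ≤ u.lo 1) : 0 < u.f x := by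
  have hmem : u.lo 0 ∈ closure {x | 0 < u.f x} := by
    rw [u.cut_zero_eq.1]; exact ⟨le_rfl, u.cut_zero_eq.2⟩
  obtain ⟨s, hs, hs'⟩ := mem_closure_iff.1 hmem (Iio x) isOpen_Iio h
  exact lt_of_lt_of_le hs' (u.mono (le_of_lt hs) h')

lemma lo_apply_spec {q : ℝ} (h : u.lo 0 ≤ q) (h' : q ≤ u.lo 1) :
    u.lo 0 ≤ u.lo (u.f q) ∧ u.lo (u.f q) ≤ q ∧ u.f (u.lo (u.f q)) = u.f q := by
  rcases (u.nonneg q).eq_or_lt with h0 | h0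
  · have hq : q = u.lo 0 := by
      by_contra hne
      exact absurd (u.pos_of_lo_zero_lt (h.lt_of_ne' hne) h') (by rw [← h0]; exact lt_irrefl _)
    rw [← h0, ← hq, ← h0]
    simp
  · have hcut := u.cut_eq h0 (u.le_one q)
    have hle := ((u.le_apply_iff h0 (u.le_one q) q).1 le_rfl).1
    have hge := (u.le_apply_iff h0 (u.le_one q) _).2 ⟨le_rfl, hcut.2⟩
    exact ⟨(u.mem_of_pos (h0.trans_le hge)).1, hle, le_antisymm (u.mono hle h') hge⟩

lemma isClosed_cut (α : ℝ) : IsClosed {x | α ≤ u.f x} := by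
  rcases le_or_gt α 0 with h | h
  · convert isClosed_univ
    exact eq_univ_of_forall fun x => h.trans (u.nonneg x)
  rcases le_or_gt α 1 with h1 | h1
  · rw [(u.cut_eq h h1).1]; exact isClosed_Icc
  · convert isClosed_empty
    exact eq_empty_of_forall_notMem fun x hx => absurd (u.le_one x) (not_le.2 (h1.trans_le hx))

end Basic

/-- The reflection `x ↦ u (-x)` of a fuzzy number. -/
noncomputable def reflect (u : FuzzyNumber) : FuzzyNumber where
  f x := u.f (-x)
  mem_Icc x := u.mem_Icc (-x)
  cut_isIcc α hα := by
    obtain ⟨a, b, hab, h⟩ := u.cut_isIcc α hα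
    refine ⟨-b, -a, neg_le_neg hab, ?_⟩
    rw [← Set.neg_Icc, ← h]
    rfl
  supp_isIcc := by
    obtain ⟨a, b, hab, h⟩ := u.supp_isIcc
    refine ⟨-b, -a, neg_le_neg hab, ?_⟩
    rw [← Set.neg_Icc, ← h]
    exact ((Homeomorph.neg ℝ).preimage_closure {x | 0 < u.f x}).symm

section Reflect

variable (u w : FuzzyNumber)

lemma reflect_apply (x : ℝ) : u.reflect.f x = u.f (-x) := rfl

lemma cut_reflect (α : ℝ) : u.reflect.cut α = Neg.neg ⁻¹' u.cut α := by
  unfold cut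
  split_ifs
  · exact ((Homeomorph.neg ℝ).preimage_closure {x | 0 < u.f x}).symm
  · rfl

lemma lo_reflect (α : ℝ) : u.reflect.lo α = -u.hi α := by
  rw [lo, hi, cut_reflect, Set.neg_preimage, Real.sInf_neg]

lemma hi_reflect (α : ℝ) : u.reflect.hi α = -u.lo α := by
  rw [lo, hi, cut_reflect, Set.neg_preimage, Real.sSup_neg]

lemma conv_reflect (z : ℝ) : u.reflect.conv w.reflect z = u.conv w (-z) := by
  refine (Equiv.neg ℝ).iSup_congr fun y => ?_
  simp only [reflect, Equiv.neg_apply]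
  congr 2
  ring

end Reflect

section Conv

variable {u w : FuzzyNumber}

lemma conv_bddAbove (z : ℝ) : BddAbove (range fun y => min (u.f y) (w.f (z - y))) :=
  ⟨1, by rintro _ ⟨y, rfl⟩; exact (min_le_left _ _).trans (u.le_one y)⟩

lemma conv_le_one (z : ℝ) : u.conv w z ≤ 1 :=
  ciSup_le fun y => (min_le_left _ _).trans (u.le_one y)

lemma min_le_conv (p z : ℝ) : min (u.f p) (w.f (z - p)) ≤ u.conv w z :=
  le_ciSup (conv_bddAbove z) p

lemma conv_le_max {a b p z : ℝ} (hp : ∀ y < p, u.f y ≤ a) (hq : ∀ x ≤ z - p, w.f x ≤ b) :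
    u.conv w z ≤ max a b := by
  refine ciSup_le fun y => ?_
  rcases lt_or_ge y p with h | h
  · exact (min_le_left _ _).trans ((hp y h).trans (le_max_left _ _))
  · exact (min_le_right _ _).trans ((hq _ (by linarith)).trans (le_max_right _ _))

lemma conv_eq_one {z : ℝ} (h : u.lo 1 + w.lo 1 ≤ z) (h' : z ≤ u.hi 1 + w.hi 1) :
    u.conv w z = 1 := by
  have hu := u.lo_one_le_hi_one
  have hw := w.lo_one_le_hi_one
  refine le_antisymm (conv_le_one z) ?_
  have hmin := min_le_conv (u := u) (w := w) (max (u.lo 1) (z - w.hi 1)) z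
  rwa [u.apply_eq_one (le_max_left _ _) (max_le hu (by linarith)), w.apply_eq_one, min_self]
    at hmin
  · rcases max_cases (u.lo 1) (z - w.hi 1) with h | h <;> linarith
  · linarith [le_max_right (u.lo 1) (z - w.hi 1)]

end Conv

end FuzzyNumber

lemma hasDerivWithinAt_of_min_le_of_le_max {f g v : ℝ → ℝ} {D z : ℝ} {s : Set ℝ}
    (hf : HasDerivWithinAt f D s z) (hg : HasDerivWithinAt g D s z)
    (hfz : f z = v z) (hgz : g z = v z)
    (hmin : ∀ᶠ x in 𝓝[s] z, min (f x) (g x) ≤ v x)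
    (hmax : ∀ᶠ x in 𝓝[s] z, v x ≤ max (f x) (g x)) :
    HasDerivWithinAt v D s z := by
  rw [hasDerivWithinAt_iff_isLittleO] at hf hg ⊢
  refine Asymptotics.IsBigO.trans_isLittleO (.of_bound 1 ?_) (hf.norm_left.add hg.norm_left)
  filter_upwards [hmin, hmax] with x h1 h2
  simp only [Real.norm_eq_abs]
  rw [hfz, hgz, one_mul]
  set A := (x - z) • D
  rw [abs_of_nonneg (a := |f x - v z - A| + |g x - v z - A|) (by positivity), abs_le]
  rcases min_le_iff.1 h1 with h | h <;> rcases le_max_iff.1 h2 with h' | h' <;> constructor <;>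
    linarith [neg_abs_le (f x - v z - A), le_abs_self (f x - v z - A), abs_nonneg (f x - v z - A),
      neg_abs_le (g x - v z - A), le_abs_self (g x - v z - A), abs_nonneg (g x - v z - A)]

lemma hasDerivAt_of_min_le_of_le_max {f g v : ℝ → ℝ} {D z : ℝ}
    (hf : HasDerivAt f D z) (hg : HasDerivAt g D z) (hfz : f z = v z) (hgz : g z = v z)
    (hmin : ∀ᶠ x in 𝓝 z, min (f x) (g x) ≤ v x)
    (hmax : ∀ᶠ x in 𝓝 z, v x ≤ max (f x) (g x)) :
    HasDerivAt v D z := by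
  rw [← hasDerivWithinAt_univ] at hf hg ⊢
  exact hasDerivWithinAt_of_min_le_of_le_max hf hg hfz hgz (by rwa [nhdsWithin_univ])
    (by rwa [nhdsWithin_univ])

lemma hasDerivAt_of_left_right {f : ℝ → ℝ} {D z : ℝ} (hl : HasDerivWithinAt f D (Iio z) z)
    (hr : HasDerivWithinAt f D (Ioi z) z) : HasDerivAt f D z := by
  rw [← hasDerivWithinAt_univ, ← Iic_union_Ici (a := z)]
  exact hl.Iic_of_Iio.union hr.Ici_of_Ioi

lemma HasDerivAt.eq_zero_of_right {f : ℝ → ℝ} {m q : ℝ} (h : HasDerivAt f m q)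
    (h0 : HasDerivWithinAt f 0 (Ioi q) q) : m = 0 :=
  (uniqueDiffWithinAt_Ioi q).eq_deriv _ h.hasDerivWithinAt h0

lemma HasDerivAt.eq_zero_of_eq_left {f : ℝ → ℝ} {a m q : ℝ} (h : HasDerivAt f m q)
    (haq : a < q) (hf : ∀ x ∈ Ioo a q, f x = f q) : m = 0 := by
  refine (uniqueDiffWithinAt_Iio q).eq_deriv _ h.hasDerivWithinAt ?_
  refine (hasDerivWithinAt_const q (Iio q) (f q)).congr_of_eventuallyEq ?_ rfl
  filter_upwards [Ioo_mem_nhdsLT haq] with x hx using hf x hx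

namespace FuzzyNumber

variable {u w : FuzzyNumber}

lemma exists_split (hwC : ContinuousOn w.f (Icc (w.lo 0) (w.hi 0)))
    (h0 : w.f (w.lo 0) = u.f (u.lo 0)) {z : ℝ} (hz : u.lo 0 + w.lo 0 ≤ z)
    (hz' : z ≤ u.lo 1 + w.lo 1) :
    ∃ p, u.lo 0 ≤ p ∧ p ≤ u.lo 1 ∧ w.lo 0 ≤ z - p ∧ z - p ≤ w.lo 1 ∧
      w.f (z - p) ≤ u.f p ∧ ∀ y < p, u.f y ≤ w.f (z - p) := by
  have hu := u.lo_zero_le_lo_one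
  have hw := w.lo_zero_le_lo_one
  have hwhi := w.lo_one_le_hi_one.trans w.hi_one_le_hi_zero
  set a := max (u.lo 0) (z - w.lo 1) with ha
  set b := min (u.lo 1) (z - w.lo 0) with hb
  have hab : a ≤ b := max_le (le_min hu (by linarith)) (le_min (by linarith) (by linarith))
  have hau : u.lo 0 ≤ a := le_max_left _ _
  have haw : z - w.lo 1 ≤ a := le_max_right _ _
  have hbu : b ≤ u.lo 1 := min_le_left _ _
  have hbw : b ≤ z - w.lo 0 := min_le_right _ _
  have hg : ContinuousOn (fun y => w.f (z - y)) (Icc a b) := by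
    refine hwC.comp (by fun_prop) fun y hy => ⟨?_, ?_⟩ <;> linarith [hy.1, hy.2]
  set S := {y | y ∈ Icc a b ∧ w.f (z - y) ≤ u.f y} with hS
  have hclosed : IsClosed S := by
    have : S = ⋂ α : ℝ, (Icc a b ∩ (fun y => w.f (z - y)) ⁻¹' Iic α) ∪
        (Icc a b ∩ {y | α ≤ u.f y}) := by
      ext y
      simp only [hS, mem_ofPred_eq, mem_iInter, mem_union, mem_inter_iff, mem_preimage, mem_Iic,
        ← and_or_left]
      refine ⟨fun h α => ⟨h.1, (le_total _ α).imp_right fun hα => hα.trans h.2⟩,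
        fun h => ⟨(h 0).1, ?_⟩⟩
      by_contra! hlt
      obtain ⟨α, h1, h2⟩ := exists_between hlt
      rcases (h α).2 with h3 | h3 <;> linarith
    rw [this]
    exact isClosed_iInter fun α => (hg.preimage_isClosed_of_isClosed isClosed_Icc isClosed_Iic).union
      (isClosed_Icc.inter (u.isClosed_cut α))
  have hne : S.Nonempty := by
    refine ⟨b, ⟨hab, le_rfl⟩, ?_⟩
    rcases le_total (u.lo 1) (z - w.lo 0) with h | h
    · rw [hb, min_eq_left h, u.apply_lo_one]; exact w.le_one _
    · rw [show z - b = w.lo 0 by rw [hb, min_eq_right h]; ring, h0]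
      exact u.mono (hau.trans hab) hbu
  obtain ⟨p, ⟨hpab, hp⟩, hmin⟩ :=
    (isCompact_Icc.of_isClosed_subset hclosed fun y hy => hy.1).exists_isLeast hne
  refine ⟨p, hau.trans hpab.1, hpab.2.trans hbu, by linarith [hpab.2], by linarith [hpab.1], hp,
    fun y hy => ?_⟩
  rcases lt_or_ge y (u.lo 0) with hy0 | hy0
  · rw [u.eq_zero_of_lt hy0]; exact w.nonneg _
  rcases hpab.1.eq_or_lt with hap | hap
  · have : p = z - w.lo 1 := by
      rw [← hap]
      exact (max_choice _ _).resolve_left fun h => by rw [← hap, ha, h] at hy; linarith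
    rw [this, sub_sub_cancel, w.apply_lo_one]
    exact u.le_one y
  have hlt : max y a < p := max_lt hy hap
  have : (𝓝[Ioo (max y a) p] p).NeBot := by
    rw [nhdsWithin_Ioo_eq_nhdsLT hlt]; infer_instance
  have hlim : Tendsto (fun y => w.f (z - y)) (𝓝[Ioo (max y a) p] p) (𝓝 (w.f (z - p))) :=
    (hg p hpab).mono fun x hx => ⟨(le_max_right y a).trans hx.1.le, hx.2.le.trans hpab.2⟩
  refine ge_of_tendsto hlim ?_
  filter_upwards [self_mem_nhdsWithin] with x hx
  have hxy : y < x := (le_max_left y a).trans_lt hx.1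
  have hxa : a < x := (le_max_right y a).trans_lt hx.1
  refine (u.mono hxy.le (hx.2.le.trans (hpab.2.trans hbu))).trans ?_
  by_contra! hc
  exact absurd (hmin ⟨⟨hxa.le, hx.2.le.trans hpab.2⟩, hc.le⟩) (not_le.2 hx.2)

lemma differentiableAt_conv_left
    (hwC : ContinuousOn w.f (Icc (w.lo 0) (w.hi 0)))
    (hwD : ∀ x ∈ Ioo (w.lo 0) (w.hi 0), DifferentiableAt ℝ w.f x)
    (h0 : w.f (w.lo 0) = u.f (u.lo 0))
    (h4 : ∀ x ∈ Ioo (u.lo 0) (u.lo 1), ¬ DifferentiableAt ℝ u.f x →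
      HasRightDerivAt w.f 0 (w.lo (u.f x)))
    (h5 : ∀ x, u.lo 0 < x → x ≤ u.lo 1 → ¬ ContinuousWithinAt u.f (Iio x) x →
      ∀ β, Tendsto u.f (𝓝[<] x) (𝓝 β) → HasRightDerivAt w.f 0 (w.lo β))
    {z : ℝ} (hz : u.lo 0 + w.lo 0 < z) (hz' : z < u.lo 1 + w.lo 1) :
    DifferentiableAt ℝ (u.conv w) z := by
  obtain ⟨p, hp0, hp1, hq0, hq1, hqp, hlt⟩ := exists_split hwC h0 hz.le hz'.le
  obtain ⟨q, hq⟩ : ∃ q, q = z - p := ⟨_, rfl⟩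
  rw [← hq] at hq0 hq1 hqp hlt
  have hwhi := w.lo_one_le_hi_one.trans w.hi_one_le_hi_zero
  have hq1 : q < w.lo 1 := by
    refine hq1.lt_of_ne fun h => ?_
    rw [h, w.apply_lo_one] at hqp
    linarith [u.lo_one_le_of_apply (le_antisymm (u.le_one p) hqp)]
  have hα : w.f q < 1 := (w.le_one q).lt_of_ne fun h => absurd (w.lo_one_le_of_apply h) hq1.not_ge
  have hvz : u.conv w z = w.f q := by
    refine le_antisymm ?_ ?_
    · simpa using conv_le_max hlt
        (fun x hx => w.mono (show x ≤ q by rw [hq]; exact hx) hq1.le)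
    · simpa [← hq, hqp] using min_le_conv (u := u) (w := w) p z
  -- bounds with `p` fixed and the increment put on `q`
  have hcont : Tendsto (fun x => x - p) (𝓝 z) (𝓝 q) := by
    rw [hq]; exact (continuous_sub_right p).tendsto z
  have hnear : ∀ᶠ x in 𝓝 z, x - p < w.lo 1 := hcont.eventually (gt_mem_nhds hq1)
  have hup : ∀ᶠ x in 𝓝 z, u.conv w x ≤ max (w.f q) (w.f (x - p)) := by
    filter_upwards [hnear] with x hx
    exact conv_le_max hlt fun y hy => w.mono hy hx.le
  have hlow : ∀ x, min (w.f q) (w.f (x - p)) ≤ u.conv w x := fun x =>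
    (min_le_min_right _ hqp).trans (min_le_conv p x)
  -- a vanishing right derivative of `w` at `q` suffices
  have hright : HasRightDerivAt w.f 0 q → DifferentiableAt ℝ (u.conv w) z := by
    intro hr
    have hconst (s : Set ℝ) := hasDerivWithinAt_const z s (w.f q)
    have hR : HasDerivWithinAt (u.conv w) 0 (Ioi z) z := by
      have hcomp : HasDerivWithinAt (fun x => w.f (x - p)) 0 (Ioi z) z := by
        rw [HasRightDerivAt, hq] at hr
        simpa [Function.comp_def] using hr.comp z ((hasDerivAt_id z).sub_const p).hasDerivWithinAt
          (fun x hx => sub_lt_sub_right (mem_Ioi.1 hx) p)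
      exact hasDerivWithinAt_of_min_le_of_le_max (hconst _) hcomp hvz.symm (by rw [hvz, hq])
        (Eventually.of_forall hlow) (nhdsWithin_le_nhds hup)
    rcases hq0.eq_or_lt with hq0 | hq0
    · refine (hasDerivAt_of_left_right ?_ hR).differentiableAt
      have hp0 : u.lo 0 < p := by linarith
      have hpz : Tendsto (fun x => x - q) (𝓝 z) (𝓝 p) := by
        have := (continuous_sub_right q).tendsto z
        rwa [show z - q = p by linarith] at this
      refine hasDerivWithinAt_of_min_le_of_le_max (hconst _) (hconst _) hvz.symm hvz.symm ?_ ?_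
      · filter_upwards [nhdsWithin_le_nhds (hpz.eventually (lt_mem_nhds hp0)),
          self_mem_nhdsWithin] with x hx hxz
        have hxz : x < z := hxz
        refine le_trans ?_ (min_le_conv (x - q) x)
        rw [sub_sub_cancel]
        refine min_le_min_right _ ?_
        rw [← hq0, h0]
        exact u.mono (by linarith) (by linarith)
      · filter_upwards [self_mem_nhdsWithin] with x hx
        have hx : x < z := hx
        exact conv_le_max hlt fun y hy => w.mono (by linarith) hq1.le
    · have hd := (hwD q ⟨hq0, hq1.trans_le hwhi⟩).hasDerivAt
      rw [hd.eq_zero_of_right hr] at hd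
      have hcomp : HasDerivAt (fun x => w.f (x - p)) 0 z := by
        rw [hq] at hd
        exact hd.comp_sub_const z p
      exact (hasDerivAt_of_min_le_of_le_max (hasDerivAt_const z (w.f q)) hcomp hvz.symm
        (by rw [hvz, hq]) (Eventually.of_forall hlow) hup).differentiableAt
  by_cases hr : HasRightDerivAt w.f 0 q
  · exact hright hr
  obtain ⟨hlo0, hlole, hloeq⟩ := w.lo_apply_spec hq0 hq1.le
  have hloq : w.lo (w.f q) = q := by
    by_contra hne
    have hlt' := hlole.lt_of_ne hne
    have hd := (hwD q ⟨hlo0.trans_lt hlt', hq1.trans_le hwhi⟩).hasDerivAt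
    rw [hd.eq_zero_of_eq_left hlt' fun x hx => le_antisymm (w.mono hx.2.le hq1.le)
      (hloeq.symm.le.trans (w.mono hx.1.le (hx.2.le.trans hq1.le)))] at hd
    exact hr hd.hasDerivWithinAt
  have hp0 : u.lo 0 < p := by
    refine hp0.lt_of_ne fun h => ?_
    have hwq : w.f q = w.f (w.lo 0) :=
      le_antisymm (by rw [h0, h]; exact hqp) (w.mono hq0 hq1.le)
    have := (w.lo_apply_spec le_rfl w.lo_zero_le_lo_one).2.1
    rw [← hwq, hloq] at this
    linarith
  rcases hqp.eq_or_lt with heq | hgt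
  · have hp1 : p < u.lo 1 := hp1.lt_of_ne fun h => by
      rw [h, u.apply_lo_one] at heq; exact hα.ne heq
    have hud : DifferentiableAt ℝ u.f p := by
      by_contra hnd
      have := h4 p ⟨hp0, hp1⟩ hnd
      rw [← heq, hloq] at this
      exact hr this
    have hsplit : ∀ t D : ℝ, HasDerivAt (fun x => u.f (p + t * (x - z))) D z →
        HasDerivAt (fun x => w.f (q + (1 - t) * (x - z))) D z →
        DifferentiableAt ℝ (u.conv w) z := by
      intro t D hf hg
      refine (hasDerivAt_of_min_le_of_le_max hf hg (by simp [hvz, heq]) (by simp [hvz])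
        (Eventually.of_forall fun x => ?_) ?_).differentiableAt
      · have := min_le_conv (u := u) (w := w) (p + t * (x - z)) x
        rwa [show x - (p + t * (x - z)) = q + (1 - t) * (x - z) by rw [hq]; ring] at this
      · have c1 : Tendsto (fun x => p + t * (x - z)) (𝓝 z) (𝓝 p) := by
          have : Continuous fun x => p + t * (x - z) := by fun_prop
          simpa using this.tendsto z
        have c2 : Tendsto (fun x => q + (1 - t) * (x - z)) (𝓝 z) (𝓝 q) := by
          have : Continuous fun x => q + (1 - t) * (x - z) := by fun_prop
          simpa using this.tendsto z
        filter_upwards [c1.eventually (gt_mem_nhds hp1), c2.eventually (gt_mem_nhds hq1)]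
          with x hx1 hx2
        exact conv_le_max (fun y hy => u.mono hy.le hx1.le)
          fun y hy => w.mono (hy.trans_eq (by rw [hq]; ring)) hx2.le
    have hu' := hud.hasDerivAt
    have hu (t : ℝ) : HasDerivAt (fun x => u.f (p + t * (x - z))) (deriv u.f p * t) z := by
      have hin : HasDerivAt (fun x => p + t * (x - z)) t z := by
        simpa using (((hasDerivAt_id z).sub_const z).const_mul t).const_add p
      exact HasDerivAt.comp z (by simpa using hu') hin
    rcases hq0.eq_or_lt with hq0 | hq0
    · have hd0 : deriv u.f p = 0 := hu'.eq_zero_of_eq_left hp0 fun x hx =>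
        le_antisymm ((hlt x hx.2).trans_eq heq)
          (by rw [← heq, ← hq0, h0]; exact u.mono hx.1.le (hx.2.le.trans hp1.le))
      refine hsplit 1 0 (by simpa [hd0] using hu 1) ?_
      simpa using hasDerivAt_const z (w.f q)
    · have hw' := (hwD q ⟨hq0, hq1.trans_le hwhi⟩).hasDerivAt
      have hw (t : ℝ) : HasDerivAt (fun x => w.f (q + t * (x - z))) (deriv w.f q * t) z := by
        have hin : HasDerivAt (fun x => q + t * (x - z)) t z := by
          simpa using (((hasDerivAt_id z).sub_const z).const_mul t).const_add q
        exact HasDerivAt.comp z (by simpa using hw') hin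
      have hm : 0 < deriv w.f q := (w.deriv_nonneg hq1).lt_of_ne' fun h =>
        hr (by rw [h] at hw'; exact hw'.hasDerivWithinAt)
      have hd : 0 ≤ deriv u.f p := u.deriv_nonneg hp1
      set m := deriv w.f q
      set d := deriv u.f p
      refine hsplit (m / (d + m)) (d * (m / (d + m))) (hu _) ?_
      convert hw _ using 1
      field_simp
      ring
  · by_cases hβ : ∃ β < w.f q, ∀ y < p, u.f y ≤ β
    · obtain ⟨β, hβ, hle⟩ := hβ
      have hq0 : w.lo 0 < q := by
        refine hq0.lt_of_ne fun h => ?_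
        have := hle (u.lo 0) hp0
        rw [← h0, h] at this
        linarith
      have hd := (hwD q ⟨hq0, hq1.trans_le hwhi⟩)
      have hcomp : DifferentiableAt ℝ (fun x => w.f (x - p)) z := by
        rw [hq] at hd
        exact hd.comp z (by fun_prop)
      refine hcomp.congr_of_eventuallyEq ?_
      have hwc : Tendsto (fun x => w.f (x - p)) (𝓝 z) (𝓝 (w.f q)) :=
        hd.continuousAt.tendsto.comp hcont
      filter_upwards [hnear, hwc.eventually (lt_mem_nhds hβ), hwc.eventually (gt_mem_nhds hgt)]
        with x hx hx1 hx2
      refine le_antisymm ?_ ?_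
      · simpa [hx1.le] using conv_le_max hle fun y (hy : y ≤ x - p) => w.mono hy hx.le
      · simpa [hx2.le] using min_le_conv (u := u) (w := w) p x
    · push Not at hβ
      have hlim : Tendsto u.f (𝓝[<] p) (𝓝 (w.f q)) := by
        refine tendsto_order.2 ⟨fun β hβ' => ?_, fun γ hγ => ?_⟩
        · obtain ⟨y, hy, hβy⟩ := hβ β hβ'
          filter_upwards [Ioo_mem_nhdsLT hy] with x hx
          exact hβy.trans_le (u.mono hx.1.le (hx.2.le.trans hp1))
        · filter_upwards [self_mem_nhdsWithin] with x hx using (hlt x hx).trans_lt hγ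
      have := h5 p hp0 hp1 (fun hc => hgt.ne (tendsto_nhds_unique hlim hc)) _ hlim
      rw [hloq] at this
      exact absurd this hr

end FuzzyNumber

namespace FuzzyNumber

variable {u w : FuzzyNumber}

lemma hasDerivWithinAt_conv_lo_one
    (hwD : ∀ x ∈ Ioo (w.lo 0) (w.hi 0), DifferentiableAt ℝ w.f x)
    (h0 : w.f (w.lo 0) = u.f (u.lo 0))
    (h2 : u.lo 1 ∈ Ioo (u.lo 0) (u.hi 0) → ¬ DifferentiableAt ℝ u.f (u.lo 1) →
      HasLeftDerivAt w.f 0 (w.lo 1))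
    (hl : u.lo 0 + w.lo 0 < u.lo 1 + w.lo 1) (hr : u.lo 1 + w.lo 1 < u.hi 0 + w.hi 0) :
    HasDerivWithinAt (u.conv w) 0 (Iio (u.lo 1 + w.lo 1)) (u.lo 1 + w.lo 1) := by
  set z := u.lo 1 + w.lo 1 with hz
  have hu := u.lo_one_le_hi_one.trans u.hi_one_le_hi_zero
  have hw := w.lo_one_le_hi_one.trans w.hi_one_le_hi_zero
  have hvz : u.conv w z = 1 :=
    conv_eq_one le_rfl (add_le_add u.lo_one_le_hi_one w.lo_one_le_hi_one)
  have hmax (x : FuzzyNumber) (h : DifferentiableAt ℝ x.f (x.lo 1)) :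
      HasDerivAt x.f 0 (x.lo 1) := by
    have hloc : IsLocalMax x.f (x.lo 1) :=
      Eventually.of_forall fun y => by rw [x.apply_lo_one]; exact x.le_one y
    rw [← hloc.deriv_eq_zero]
    exact h.hasDerivAt
  have hcase : HasDerivWithinAt u.f 0 (Iio (u.lo 1)) (u.lo 1) ∨
      HasDerivWithinAt w.f 0 (Iio (w.lo 1)) (w.lo 1) := by
    have hu1 : u.lo 0 = u.lo 1 → w.lo 0 = w.lo 1 := fun h =>
      le_antisymm w.lo_zero_le_lo_one
        (w.lo_one_le_of_apply (by rw [h0, h, u.apply_lo_one]))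
    have hw1 : w.lo 0 = w.lo 1 → u.lo 0 = u.lo 1 := fun h =>
      le_antisymm u.lo_zero_le_lo_one
        (u.lo_one_le_of_apply (by rw [← h0, h, w.apply_lo_one]))
    have hwl : w.lo 0 < w.lo 1 := w.lo_zero_le_lo_one.lt_of_ne fun h => by linarith [hw1 h]
    have hul : u.lo 0 < u.lo 1 := u.lo_zero_le_lo_one.lt_of_ne fun h => by linarith [hu1 h]
    rcases hw.eq_or_lt with hwr | hwr
    · by_cases hd : DifferentiableAt ℝ u.f (u.lo 1)
      · exact .inl (hmax u hd).hasDerivWithinAt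
      · exact .inr (h2 ⟨hul, by linarith⟩ hd)
    · exact .inr (hmax w (hwD _ ⟨hwl, hwr⟩)).hasDerivWithinAt
  have hone := hasDerivWithinAt_const z (Iio z) (1 : ℝ)
  have hle (g : ℝ → ℝ) : ∀ᶠ x in 𝓝[Iio z] z, u.conv w x ≤ max 1 (g x) :=
    Eventually.of_forall fun x => (conv_le_one x).trans (le_max_left _ _)
  rcases hcase with h | h
  · have hzw : z - w.lo 1 = u.lo 1 := by rw [hz]; ring
    have hcomp : HasDerivWithinAt (fun x => u.f (x - w.lo 1)) 0 (Iio z) z := by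
      rw [← hzw] at h
      simpa [Function.comp_def] using h.comp z ((hasDerivAt_id z).sub_const (w.lo 1)).hasDerivWithinAt
        (fun x hx => sub_lt_sub_right (mem_Iio.1 hx) _)
    refine hasDerivWithinAt_of_min_le_of_le_max hone hcomp hvz.symm
      (by rw [hvz, hzw, u.apply_lo_one]) (Eventually.of_forall fun x => ?_) (hle _)
    have := min_le_conv (u := u) (w := w) (x - w.lo 1) x
    rwa [sub_sub_cancel, w.apply_lo_one, min_comm] at this
  · have hzu : z - u.lo 1 = w.lo 1 := by rw [hz]; ring
    have hcomp : HasDerivWithinAt (fun x => w.f (x - u.lo 1)) 0 (Iio z) z := by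
      rw [← hzu] at h
      simpa [Function.comp_def] using h.comp z ((hasDerivAt_id z).sub_const (u.lo 1)).hasDerivWithinAt
        (fun x hx => sub_lt_sub_right (mem_Iio.1 hx) _)
    refine hasDerivWithinAt_of_min_le_of_le_max hone hcomp hvz.symm
      (by rw [hvz, hzu, w.apply_lo_one]) (Eventually.of_forall fun x => ?_) (hle _)
    have := min_le_conv (u := u) (w := w) (u.lo 1) x
    rwa [u.apply_lo_one] at this

lemma hasDerivWithinAt_conv_Iio_of_core
    (hwD : ∀ x ∈ Ioo (w.lo 0) (w.hi 0), DifferentiableAt ℝ w.f x)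
    (h0 : w.f (w.lo 0) = u.f (u.lo 0))
    (h2 : u.lo 1 ∈ Ioo (u.lo 0) (u.hi 0) → ¬ DifferentiableAt ℝ u.f (u.lo 1) →
      HasLeftDerivAt w.f 0 (w.lo 1))
    {z : ℝ} (hl : u.lo 0 + w.lo 0 < z) (hr : z < u.hi 0 + w.hi 0)
    (h1 : u.lo 1 + w.lo 1 ≤ z) (h1' : z ≤ u.hi 1 + w.hi 1) :
    HasDerivWithinAt (u.conv w) 0 (Iio z) z := by
  rcases h1.eq_or_lt with rfl | h1
  · exact hasDerivWithinAt_conv_lo_one hwD h0 h2 hl hr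
  · refine (hasDerivWithinAt_const z _ (1 : ℝ)).congr_of_eventuallyEq ?_ (conv_eq_one h1.le h1')
    filter_upwards [Ioo_mem_nhdsLT h1] with x hx
    exact conv_eq_one hx.1.le (hx.2.le.trans h1')

lemma continuousWithinAt_conv_left
    (hwC : ContinuousOn w.f (Icc (w.lo 0) (w.hi 0)))
    (h0 : w.f (w.lo 0) = u.f (u.lo 0)) (h0' : w.f (w.hi 0) = u.f (u.hi 0)) :
    ContinuousWithinAt (u.conv w) (Icc (u.lo 0 + w.lo 0) (u.hi 0 + w.hi 0))
      (u.lo 0 + w.lo 0) := by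
  set z := u.lo 0 + w.lo 0 with hz
  have hzw : z - u.lo 0 = w.lo 0 := by rw [hz]; ring
  have hw0 := w.lo_zero_le_lo_one
  have hw1 := w.lo_one_le_hi_one.trans w.hi_one_le_hi_zero
  have hvz : u.conv w z = w.f (w.lo 0) := by
    refine le_antisymm ?_ ?_
    · have := conv_le_max (u := u) (w := w) (a := 0) (b := w.f (w.lo 0)) (p := u.lo 0) (z := z)
        (fun y hy => (u.eq_zero_of_lt hy).le)
        (fun x hx => w.mono (hx.trans_eq hzw) hw0)
      rwa [max_eq_right (w.nonneg _)] at this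
    · have := min_le_conv (u := u) (w := w) (u.lo 0) z
      rwa [hzw, ← h0, min_self] at this
  rcases (hw0.trans hw1).eq_or_lt with hw | hw
  · have hlo : w.lo 0 = w.lo 1 := le_antisymm hw0 (by linarith)
    have hone : w.f (w.lo 0) = 1 := by rw [hlo, w.apply_lo_one]
    have hu1 : u.lo 1 ≤ u.lo 0 := u.lo_one_le_of_apply (by rw [← h0, hone])
    have hu2 : u.hi 0 ≤ u.hi 1 := u.le_hi_one_of_apply (by rw [← h0', ← hw, hone])
    refine (continuousWithinAt_const (b := (1 : ℝ))).congr (fun x hx => ?_) (hvz.trans hone)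
    refine conv_eq_one (by linarith [hx.1]) ?_
    linarith [hx.2, w.lo_one_le_hi_one]
  · have hnear : Tendsto (fun x => x - u.lo 0) (𝓝 z) (𝓝 (w.lo 0)) := by
      rw [← hzw]; exact (continuous_sub_right (u.lo 0)).tendsto z
    set s := Icc (u.lo 0 + w.lo 0) (u.hi 0 + w.hi 0) with hs
    have hwlim : Tendsto (fun x => w.f (x - u.lo 0)) (𝓝[s] z) (𝓝 (w.f (w.lo 0))) := by
      refine (hwC (w.lo 0) ⟨le_rfl, hw.le⟩).tendsto.comp
        (tendsto_nhdsWithin_iff.2 ⟨hnear.mono_left nhdsWithin_le_nhds, ?_⟩)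
      filter_upwards [self_mem_nhdsWithin,
        nhdsWithin_le_nhds (hnear.eventually (gt_mem_nhds hw))] with x hx hx'
      exact ⟨by linarith [hx.1], hx'.le⟩
    rw [ContinuousWithinAt, hvz]
    have hlow : Tendsto (fun x => min (w.f (w.lo 0)) (w.f (x - u.lo 0))) (𝓝[s] z)
        (𝓝 (w.f (w.lo 0))) := by
      simpa using (tendsto_const_nhds (x := w.f (w.lo 0))).min hwlim
    have hlow' : ∀ x, min (w.f (w.lo 0)) (w.f (x - u.lo 0)) ≤ u.conv w x := fun x => by
      rw [h0]; exact min_le_conv _ x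
    rcases hw0.eq_or_lt with h | h
    · have hone : w.f (w.lo 0) = 1 := by rw [h, w.apply_lo_one]
      refine tendsto_of_tendsto_of_tendsto_of_le_of_le hlow tendsto_const_nhds hlow' fun x => ?_
      exact (conv_le_one x).trans_eq hone.symm
    · refine tendsto_of_tendsto_of_tendsto_of_le_of_le' hlow hwlim (Eventually.of_forall hlow') ?_
      filter_upwards [nhdsWithin_le_nhds (hnear.eventually (gt_mem_nhds h))] with x hx
      have := conv_le_max (u := u) (w := w) (a := 0) (b := w.f (x - u.lo 0)) (p := u.lo 0) (z := x)
        (fun y hy => (u.eq_zero_of_lt hy).le) (fun y hy => w.mono hy hx.le)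
      rwa [max_eq_right (w.nonneg _)] at this

end FuzzyNumber

lemma hasDerivWithinAt_comp_neg {f : ℝ → ℝ} {f' x : ℝ} {s : Set ℝ}
    (h : HasDerivWithinAt f f' s (-x)) :
    HasDerivWithinAt (fun y => f (-y)) (-f') (Neg.neg ⁻¹' s) x := by
  simpa [Function.comp_def] using h.comp x (hasDerivAt_neg x).hasDerivWithinAt (mapsTo_preimage _ _)

lemma HasLeftDerivAt.comp_neg {f : ℝ → ℝ} {f' x : ℝ} (h : HasLeftDerivAt f f' (-x)) :
    HasRightDerivAt (fun y => f (-y)) (-f') x := by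
  simpa [HasRightDerivAt] using hasDerivWithinAt_comp_neg h

lemma HasRightDerivAt.comp_neg {f : ℝ → ℝ} {f' x : ℝ} (h : HasRightDerivAt f f' (-x)) :
    HasLeftDerivAt (fun y => f (-y)) (-f') x := by
  simpa [HasLeftDerivAt] using hasDerivWithinAt_comp_neg h

lemma differentiableAt_comp_neg_iff {f : ℝ → ℝ} {x : ℝ} :
    DifferentiableAt ℝ (fun y => f (-y)) x ↔ DifferentiableAt ℝ f (-x) := by
  refine ⟨fun h => ?_, fun h => h.comp x differentiableAt_id.neg⟩
  rw [← neg_neg x] at h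
  simpa [Function.comp_def] using h.comp (-x) differentiableAt_id.neg

/-- Theorem `rncp`: if `u` is any fuzzy number, `w ∈ F_D(ℝ)`
and `w` satisfies conditions (i), (ii), (iv) and (v), then `u∇w ∈ F_D(ℝ)`. -/
theorem conv_memFD (u w : FuzzyNumber)
    -- `w ∈ F_D(ℝ)`
    (hwC : ContinuousOn w.f (Set.Icc (w.lo 0) (w.hi 0)))
    (hwD : ∀ x ∈ Set.Ioo (w.lo 0) (w.hi 0), DifferentiableAt ℝ w.f x)
    -- condition (i)
    (h1l : w.f (w.lo 0) = u.f (u.lo 0)) (h1r : w.f (w.hi 0) = u.f (u.hi 0))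
    -- condition (ii-1)
    (h21 : u.lo 1 ∈ Set.Ioo (u.lo 0) (u.hi 0) → ¬ DifferentiableAt ℝ u.f (u.lo 1) →
      HasLeftDerivAt w.f 0 (w.lo 1))
    -- condition (ii-2)
    (h22 : u.hi 1 ∈ Set.Ioo (u.lo 0) (u.hi 0) → ¬ DifferentiableAt ℝ u.f (u.hi 1) →
      HasRightDerivAt w.f 0 (w.hi 1))
    -- condition (iv)
    (h4 : ∀ x ∈ Set.Ioo (u.lo 0) (u.hi 0), ¬ DifferentiableAt ℝ u.f x →
      (x ∈ Set.Ioo (u.lo 0) (u.lo 1) → HasRightDerivAt w.f 0 (w.lo (u.f x))) ∧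
      (x ∈ Set.Ioo (u.hi 1) (u.hi 0) → HasLeftDerivAt w.f 0 (w.hi (u.f x))))
    -- condition (v-1)
    (h51 : ∀ x, u.lo 0 < x → x ≤ u.lo 1 → ¬ ContinuousWithinAt u.f (Set.Iio x) x →
      ∀ β, Filter.Tendsto u.f (nhdsWithin x (Set.Iio x)) (nhds β) →
        HasRightDerivAt w.f 0 (w.lo β))
    -- condition (v-2)
    (h52 : ∀ x, u.hi 1 ≤ x → x < u.hi 0 → ¬ ContinuousWithinAt u.f (Set.Ioi x) x →
      ∀ γ, Filter.Tendsto u.f (nhdsWithin x (Set.Ioi x)) (nhds γ) →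
        HasLeftDerivAt w.f 0 (w.hi γ)) :
    -- conclusion: `u∇w ∈ F_D(ℝ)`
    ContinuousOn (u.conv w) (Set.Icc (u.lo 0 + w.lo 0) (u.hi 0 + w.hi 0)) ∧
    ∀ x ∈ Set.Ioo (u.lo 0 + w.lo 0) (u.hi 0 + w.hi 0),
      DifferentiableAt ℝ (u.conv w) x := by
  have hwC' : ContinuousOn w.reflect.f (Icc (w.reflect.lo 0) (w.reflect.hi 0)) := by
    rw [w.lo_reflect, w.hi_reflect]
    exact hwC.comp continuousOn_neg fun x hx => ⟨le_neg.1 hx.2, neg_le.1 hx.1⟩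
  have hwD' : ∀ x ∈ Ioo (w.reflect.lo 0) (w.reflect.hi 0), DifferentiableAt ℝ w.reflect.f x := by
    rw [w.lo_reflect, w.hi_reflect]
    exact fun x hx => differentiableAt_comp_neg_iff.2 (hwD _ ⟨lt_neg.1 hx.2, neg_lt.1 hx.1⟩)
  have h0' : w.reflect.f (w.reflect.lo 0) = u.reflect.f (u.reflect.lo 0) := by
    simpa [FuzzyNumber.reflect_apply, FuzzyNumber.lo_reflect] using h1r
  have h0'' : w.reflect.f (w.reflect.hi 0) = u.reflect.f (u.reflect.hi 0) := by
    simpa [FuzzyNumber.reflect_apply, FuzzyNumber.hi_reflect] using h1l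
  have hconv : u.reflect.conv w.reflect = fun x => u.conv w (-x) :=
    funext fun x => FuzzyNumber.conv_reflect u w x
  have hdiff : ∀ x ∈ Ioo (u.lo 0 + w.lo 0) (u.hi 0 + w.hi 0),
      DifferentiableAt ℝ (u.conv w) x := by
    intro z hz
    have hu := u.lo_one_le_hi_one.trans u.hi_one_le_hi_zero
    have hu' := u.lo_zero_le_lo_one.trans u.lo_one_le_hi_one
    rcases lt_or_ge z (u.lo 1 + w.lo 1) with h | h
    · exact FuzzyNumber.differentiableAt_conv_left hwC hwD h1l
        (fun x hx hd => (h4 x ⟨hx.1, hx.2.trans_le hu⟩ hd).1 hx) h51 hz.1 h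
    rcases lt_or_ge (u.hi 1 + w.hi 1) z with h' | h'
    · have key : DifferentiableAt ℝ (u.reflect.conv w.reflect) (-z) := by
        refine FuzzyNumber.differentiableAt_conv_left hwC' hwD' h0' ?_ ?_ ?_ ?_
        · intro x hx hd
          rw [u.lo_reflect, u.lo_reflect] at hx
          have hx' : -x ∈ Ioo (u.hi 1) (u.hi 0) := ⟨lt_neg.1 hx.2, neg_lt.1 hx.1⟩
          have := (h4 (-x) ⟨hu'.trans_lt hx'.1, hx'.2⟩
            (fun h => hd (differentiableAt_comp_neg_iff.2 h))).2 hx'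
          rw [w.lo_reflect, ← neg_zero]
          exact HasLeftDerivAt.comp_neg (by rwa [neg_neg])
        · intro x hx hx' hc β hβ
          rw [u.lo_reflect] at hx hx'
          have hneg : Tendsto (fun y : ℝ => -y) (𝓝[>] (-x)) (𝓝[<] x) := by
            simpa using tendsto_neg_nhdsGT (a := -x)
          have hneg' : Tendsto (fun y : ℝ => -y) (𝓝[<] x) (𝓝[>] (-x)) := tendsto_neg_nhdsLT
          have := h52 (-x) (le_neg.1 hx') (neg_lt.1 hx) (fun h => hc (h.tendsto.comp hneg')) β
            (by simpa [FuzzyNumber.reflect_apply, Function.comp_def] using hβ.comp hneg)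
          rw [w.lo_reflect, ← neg_zero]
          exact HasLeftDerivAt.comp_neg (by rwa [neg_neg])
        · rw [u.lo_reflect, w.lo_reflect]; linarith [hz.2]
        · rw [u.lo_reflect, w.lo_reflect]; linarith
      rw [hconv, differentiableAt_comp_neg_iff, neg_neg] at key
      exact key
    · have hleft := FuzzyNumber.hasDerivWithinAt_conv_Iio_of_core hwD h1l h21 hz.1 hz.2 h h'
      have hright : HasLeftDerivAt (u.reflect.conv w.reflect) 0 (-z) := by
        refine FuzzyNumber.hasDerivWithinAt_conv_Iio_of_core hwD' h0' ?_ ?_ ?_ ?_ ?_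
        · intro hx hd
          rw [u.lo_reflect, u.lo_reflect, u.hi_reflect] at hx
          rw [u.lo_reflect] at hd
          have := h22 ⟨neg_lt_neg_iff.1 hx.2, neg_lt_neg_iff.1 hx.1⟩
            (fun h => hd (differentiableAt_comp_neg_iff.2 (by rwa [neg_neg])))
          rw [w.lo_reflect, ← neg_zero]
          exact HasRightDerivAt.comp_neg (by rwa [neg_neg])
        all_goals simp only [FuzzyNumber.lo_reflect, FuzzyNumber.hi_reflect]
        all_goals linarith [hz.1, hz.2]
      have := hright.comp_neg
      simp only [hconv, neg_neg, neg_zero] at this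
      exact (hasDerivAt_of_left_right hleft this).differentiableAt
  refine ⟨fun z hz => ?_, hdiff⟩
  rcases hz.1.eq_or_lt with rfl | hl
  · exact FuzzyNumber.continuousWithinAt_conv_left hwC h1l h1r
  rcases hz.2.eq_or_lt with rfl | hr
  · have key := FuzzyNumber.continuousWithinAt_conv_left hwC' h0' h0''
    rw [hconv] at key
    simp only [FuzzyNumber.lo_reflect, FuzzyNumber.hi_reflect, ← neg_add] at key
    have := key.comp (t := Icc (-(u.hi 0 + w.hi 0)) (-(u.lo 0 + w.lo 0)))
      (x := u.hi 0 + w.hi 0) (f := fun x => -x) (s := Icc (u.lo 0 + w.lo 0) (u.hi 0 + w.hi 0))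
      continuous_neg.continuousWithinAt
      fun x hx => ⟨neg_le_neg hx.2, neg_le_neg hx.1⟩
    simpa [Function.comp_def] using this
  · exact (hdiff z ⟨hl, hr⟩).continuousAt.continuousWithinAt
end

section
/- Let u ∈ F_N(ℝ) ∩ F_C(ℝ) with l = u(u⁻(0)) and r = u(u⁺(0)), and for p > 0 define the fuzzy number v_p by v_p(t) = 1 − (t/p)² for t ∈ [−p·√(1−l), p·√(1−r)] and v_p(t) = 0 otherwise. Then for every natural number n ≥ 1, the sup-min convolution u∇v_{1/n} belongs to F_D(ℝ) and d_∞(u∇v_{1/n}, u) ≤ 1/n; in particular, the sequence {u∇v_{1/n}} of differentiable fuzzy numbers converges to u in the supremum metric d_∞. -/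
open Set Filter Topology

/-- If `F ∘ h` is continuous on a compact set `K`, where `h` is continuous on `K`, then `F` is
continuous on the image of `K` under `h`. -/
theorem IsCompact.continuousOn_image_of_comp {X Y Z : Type*} [TopologicalSpace X]
    [TopologicalSpace Y] [TopologicalSpace Z] [T2Space Y] {K : Set X} (hK : IsCompact K)
    {h : X → Y} (hh : ContinuousOn h K) {F : Y → Z} (hF : ContinuousOn (F ∘ h) K) :
    ContinuousOn F (h '' K) := by
  have : CompactSpace K := isCompact_iff_compactSpace.mp hK
  have hcont : Continuous ((mapsTo_image h K).restrict h K (h '' K)) :=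
    hh.mapsToRestrict (mapsTo_image h K)
  have hsurj : Function.Surjective ((mapsTo_image h K).restrict h K (h '' K)) := by
    rintro ⟨_, x, hx, rfl⟩
    exact ⟨⟨x, hx⟩, rfl⟩
  have hq := hcont.isClosedMap.isQuotientMap hcont hsurj
  rw [continuousOn_iff_continuous_domRestrict, hq.continuous_iff]
  exact continuousOn_iff_continuous_domRestrict.mp hF

/-- A function that lies between `1 - ((x - m) / p) ^ 2` and `1` near `m` is differentiable
at `m`. -/
theorem differentiableAt_of_parabola_le {c : ℝ → ℝ} {m p : ℝ}
    (h : ∀ᶠ x in 𝓝 m, 1 - ((x - m) / p) ^ 2 ≤ c x) (h1 : ∀ x, c x ≤ 1) :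
    DifferentiableAt ℝ c m := by
  have hO : (fun x => c x - 1) =O[𝓝 m] fun x => ‖x - m‖ ^ 2 := by
    refine Asymptotics.IsBigO.of_bound ((1 / p) ^ 2) ?_
    filter_upwards [h] with x hx
    rw [Real.norm_eq_abs, abs_of_nonpos (by linarith [h1 x]), norm_pow, norm_norm,
      Real.norm_eq_abs, sq_abs]
    calc -(c x - 1) ≤ ((x - m) / p) ^ 2 := by linarith
      _ = _ := by ring
  simpa using (hO.hasFDerivAt one_lt_two).differentiableAt.add_const 1

/-- The sup-min convolution of two real functions. -/
noncomputable def supMin (f g : ℝ → ℝ) (x : ℝ) : ℝ := ⨆ y : ℝ, min (f y) (g (x - y))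

theorem supMin_reflect (f g : ℝ → ℝ) (x : ℝ) :
    supMin (fun y => f (-y)) (fun y => g (-y)) x = supMin f g (-x) := by
  unfold supMin
  rw [← (Equiv.neg ℝ).iSup_comp]
  refine iSup_congr fun y => ?_
  simp [sub_eq_add_neg, add_comm]

section supMin

variable {f g : ℝ → ℝ}

theorem supMin_le_one (hf : ∀ x, f x ≤ 1) (x : ℝ) : supMin f g x ≤ 1 :=
  ciSup_le fun y => (min_le_left _ _).trans (hf y)

theorem min_le_supMin (hf : ∀ x, f x ≤ 1) (x y : ℝ) : min (f y) (g (x - y)) ≤ supMin f g x :=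
  le_ciSup (f := fun y => min (f y) (g (x - y)))
    ⟨1, by rintro _ ⟨z, rfl⟩; exact (min_le_left _ _).trans (hf z)⟩ y

theorem supMin_eq_one (hf : ∀ x, f x ≤ 1) (hg : g 0 = 1) {x : ℝ} (hx : f x = 1) :
    supMin f g x = 1 := by
  refine le_antisymm (supMin_le_one hf x) ?_
  have := min_le_supMin (g := g) hf x x
  simpa [hx, hg] using this

variable {a L p q : ℝ}

theorem supMin_parabola_eq (hf : ∀ x, f x ∈ Icc (0 : ℝ) 1) (hmono : MonotoneOn f (Iic L))
    (hp : 0 < p) (hq : 0 ≤ q)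
    (hg : ∀ t, g t = if -(p * √(1 - f a)) ≤ t ∧ t ≤ q then 1 - (t / p) ^ 2 else 0)
    {y : ℝ} (hy : y ∈ Icc a L) :
    supMin f g (y - p * √(1 - f y)) = f y := by
  have h1 : ∀ x, f x ≤ 1 := fun x => (hf x).2
  have hs : √(1 - f y) ^ 2 = 1 - f y := Real.sq_sqrt (by linarith [h1 y])
  have hs0 := Real.sqrt_nonneg (1 - f y)
  apply le_antisymm
  · refine ciSup_le fun z => ?_
    rcases le_or_gt z y with hz | hz
    · exact (min_le_left _ _).trans (hmono (hz.trans hy.2) hy.2 hz)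
    · refine (min_le_right _ _).trans ?_
      rw [hg]
      split_ifs
      · have : √(1 - f y) ≤ (z - (y - p * √(1 - f y))) / p := by
          rw [le_div_iff₀ hp]; linarith
        have h2 : √(1 - f y) ^ 2 ≤ ((z - (y - p * √(1 - f y))) / p) ^ 2 := by gcongr
        have h3 : ((y - p * √(1 - f y) - z) / p) ^ 2 = ((z - (y - p * √(1 - f y))) / p) ^ 2 := by
          ring
        linarith
      · exact (hf y).1
  · refine le_trans (le_of_eq ?_) (min_le_supMin h1 _ y)
    have hfa : f a ≤ f y := hmono (hy.1.trans hy.2) hy.2 hy.1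
    have h2 : p * √(1 - f y) ≤ p * √(1 - f a) := by gcongr
    have h3 : 0 ≤ p * √(1 - f y) := by positivity
    rw [hg, if_pos ⟨by linarith, by linarith⟩]
    have h4 : (y - p * √(1 - f y) - y) / p = -√(1 - f y) := by field_simp; ring
    rw [h4, neg_sq, hs]
    simp

/-- Regularity, to the left of the core, of the sup-min convolution with a parabola. -/
theorem supMin_parabola_regular (hf : ∀ x, f x ∈ Icc (0 : ℝ) 1) (hmono : MonotoneOn f (Iic L))
    (haL : a ≤ L) (hL : f L = 1) (hlt : ∀ x < L, f x < 1) (hcont : ContinuousOn f (Icc a L))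
    (hdiff : ∀ x ∈ Ioo a L, DifferentiableAt ℝ f x) (hp : 0 < p) (hq : 0 ≤ q)
    (hg : ∀ t, g t = if -(p * √(1 - f a)) ≤ t ∧ t ≤ q then 1 - (t / p) ^ 2 else 0) :
    ContinuousOn (supMin f g) (Icc (a - p * √(1 - f a)) L) ∧
      ∀ x ∈ Ioo (a - p * √(1 - f a)) L, DifferentiableAt ℝ (supMin f g) x := by
  set h : ℝ → ℝ := fun y => y - p * √(1 - f y) with hdef
  have hch : ContinuousOn h (Icc a L) := by fun_prop
  have hhL : h L = L := by simp [hdef, hL]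
  have hsm : StrictMonoOn h (Icc a L) := by
    intro y hy z hz hyz
    have : f y ≤ f z := hmono hy.2 hz.2 hyz.le
    have h2 : p * √(1 - f z) ≤ p * √(1 - f y) := by gcongr
    simp only [hdef]
    linarith
  have himg : h '' Icc a L = Icc (h a) L := by
    apply Subset.antisymm
    · rintro _ ⟨y, hy, rfl⟩
      refine ⟨hsm.monotoneOn (left_mem_Icc.2 haL) hy hy.1, ?_⟩
      rw [← hhL]
      exact hsm.monotoneOn hy (right_mem_Icc.2 haL) hy.2
    · have := intermediate_value_Icc haL hch
      rwa [hhL] at this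
  have hcomp : ∀ y ∈ Icc a L, supMin f g (h y) = f y := fun y hy =>
    supMin_parabola_eq hf hmono hp hq hg hy
  refine ⟨?_, fun x hx => ?_⟩
  · change ContinuousOn _ (Icc (h a) L)
    rw [← himg]
    exact isCompact_Icc.continuousOn_image_of_comp hch (hcont.congr hcomp)
  · change x ∈ Ioo (h a) L at hx
    set k : ℝ → ℝ := Function.invFunOn h (Icc a L) with hk
    have hkm : ∀ z ∈ Icc (h a) L, k z ∈ Icc a L := fun z hz =>
      Function.invFunOn_mem (by rwa [← himg] at hz)
    have hhk : ∀ z ∈ Icc (h a) L, h (k z) = z := fun z hz =>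
      Function.invFunOn_eq (by rwa [← himg] at hz)
    have hkh : ∀ y ∈ Icc a L, k (h y) = y := fun y hy =>
      hsm.injOn.leftInvOn_invFunOn hy
    have hkc : ContinuousOn k (Icc (h a) L) := by
      rw [← himg]
      exact isCompact_Icc.continuousOn_image_of_comp hch (continuousOn_id.congr hkh)
    have hnhds : Icc (h a) L ∈ 𝓝 x := Icc_mem_nhds hx.1 hx.2
    have hxI : x ∈ Icc (h a) L := Ioo_subset_Icc_self hx
    have hy : k x ∈ Ioo a L := by
      have h1 := hkm x hxI
      have h2 := hhk x hxI
      refine ⟨lt_of_le_of_ne h1.1 fun e => ?_, lt_of_le_of_ne h1.2 fun e => ?_⟩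
      · rw [← e] at h2
        exact hx.1.ne h2
      · rw [e, hhL] at h2
        exact hx.2.ne h2.symm
    have hfd := (hdiff _ hy).hasDerivAt
    have hd0 : 0 ≤ deriv f (k x) := by
      have hev : Iic L ∈ 𝓝 (k x) := Iic_mem_nhds hy.2
      rw [← derivWithin_of_mem_nhds hev]
      exact hmono.derivWithin_nonneg
    have hpos : 0 < 1 - f (k x) := by linarith [hlt _ hy.2]
    have hhd := (hasDerivAt_id (k x)).sub (((hfd.const_sub 1).sqrt hpos.ne').const_mul p)
    have hne : 1 - p * (-deriv f (k x) / (2 * √(1 - f (k x)))) ≠ 0 := by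
      have : 0 ≤ p * (deriv f (k x) / (2 * √(1 - f (k x)))) := by positivity
      rw [neg_div, mul_neg]
      linarith
    have hkd : HasDerivAt k _ x := HasDerivAt.of_local_left_inverse (hkc.continuousAt hnhds)
      hhd hne (by filter_upwards [hnhds] with z hz using hhk z hz)
    have hfk : DifferentiableAt ℝ (fun z => f (k z)) x :=
      (hfd.differentiableAt).comp x hkd.differentiableAt
    refine hfk.congr_of_eventuallyEq ?_
    filter_upwards [hnhds] with z hz
    rw [← hcomp _ (hkm z hz), hhk z hz]

end supMin

namespace FuzzyNumber

variable (u : FuzzyNumber)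

theorem cut_eq_Icc {α : ℝ} (hα : α ∈ Icc (0 : ℝ) 1) :
    u.lo α ≤ u.hi α ∧ u.cut α = Icc (u.lo α) (u.hi α) := by
  have : ∃ a b : ℝ, a ≤ b ∧ u.cut α = Icc a b := by
    unfold cut
    split_ifs with h
    · exact u.supp_isIcc
    · exact u.cut_isIcc α ⟨lt_of_le_of_ne hα.1 (Ne.symm h), hα.2⟩
  obtain ⟨a, b, hab, h⟩ := this
  have hlo : u.lo α = a := by rw [lo, h, csInf_Icc hab]
  have hhi : u.hi α = b := by rw [hi, h, csSup_Icc hab]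
  rw [hlo, hhi]
  exact ⟨hab, h⟩

theorem cut_subset_cut_zero {α : ℝ} (hα : 0 ≤ α) : u.cut α ⊆ u.cut 0 := by
  rcases hα.eq_or_lt with rfl | h
  · exact Subset.rfl
  · intro x hx
    rw [cut, if_neg h.ne'] at hx
    rw [cut, if_pos rfl]
    exact subset_closure (h.trans_le hx)

theorem le_f_of_le_of_le {x y z : ℝ} {α : ℝ} (hα : 0 ≤ α) (hx : α ≤ u.f x) (hz : α ≤ u.f z)
    (hxy : x ≤ y) (hyz : y ≤ z) : α ≤ u.f y := by
  rcases hα.eq_or_lt with rfl | h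
  · exact (u.mem_Icc y).1
  · obtain ⟨a, b, -, hc⟩ := u.cut_isIcc α ⟨h, hx.trans (u.mem_Icc x).2⟩
    have hx' : x ∈ Icc a b := hc ▸ hx
    have hz' : z ∈ Icc a b := hc ▸ hz
    have : y ∈ {x | α ≤ u.f x} := hc ▸ ⟨hx'.1.trans hxy, hyz.trans hz'.2⟩
    exact this

theorem f_eq_one_iff {x : ℝ} : u.f x = 1 ↔ x ∈ Icc (u.lo 1) (u.hi 1) := by
  rw [← (u.cut_eq_Icc ⟨zero_le_one, le_rfl⟩).2, cut, if_neg one_ne_zero]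
  exact ⟨fun h => h.ge, fun h => le_antisymm (u.mem_Icc x).2 h⟩

/-- If `u` vanishes outside `[A, B]`, then all its cuts are contained in `[A, B]`. -/
theorem lo_hi_bounds {A B : ℝ} (hv : ∀ t, t ∉ Icc A B → u.f t = 0) {α : ℝ}
    (hα : α ∈ Icc (0 : ℝ) 1) : A ≤ u.lo α ∧ u.lo α ≤ u.hi α ∧ u.hi α ≤ B := by
  have hsub : u.cut 0 ⊆ Icc A B := by
    rw [cut, if_pos rfl]
    refine closure_minimal (fun x hx => ?_) isClosed_Icc
    by_contra h
    exact (show 0 < u.f x from hx).ne' (hv x h)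
  obtain ⟨h1, h2⟩ := u.cut_eq_Icc hα
  have h3 := (u.cut_subset_cut_zero hα.1).trans hsub
  rw [h2] at h3
  exact ⟨(h3 (left_mem_Icc.2 h1)).1, h1, (h3 (right_mem_Icc.2 h1)).2⟩

/-- The sup-min convolution of `u` with a truncated parabola is continuous on its `0`-cut and
differentiable in the interior. -/
theorem supMin_parabola_smooth
    (huC : ContinuousOn u.f (Icc (u.lo 0) (u.hi 0)))
    (huN : ∀ x ∈ Ioo (u.lo 0) (u.lo 1) ∪ Ioo (u.hi 1) (u.hi 0), DifferentiableAt ℝ u.f x)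
    {g : ℝ → ℝ} {p : ℝ} (hp : 0 < p)
    (hg : ∀ t, g t = if -(p * √(1 - u.f (u.lo 0))) ≤ t ∧ t ≤ p * √(1 - u.f (u.hi 0))
      then 1 - (t / p) ^ 2 else 0) :
    ContinuousOn (supMin u.f g)
        (Icc (u.lo 0 - p * √(1 - u.f (u.lo 0))) (u.hi 0 + p * √(1 - u.f (u.hi 0)))) ∧
      ∀ x ∈ Ioo (u.lo 0 - p * √(1 - u.f (u.lo 0))) (u.hi 0 + p * √(1 - u.f (u.hi 0))),
        DifferentiableAt ℝ (supMin u.f g) x := by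
  have h01 : (0 : ℝ) ∈ Icc (0 : ℝ) 1 := ⟨le_rfl, zero_le_one⟩
  have h11 : (1 : ℝ) ∈ Icc (0 : ℝ) 1 := ⟨zero_le_one, le_rfl⟩
  obtain ⟨hLR, hcut1⟩ := u.cut_eq_Icc h11
  have hsub := u.cut_subset_cut_zero zero_le_one
  rw [hcut1, (u.cut_eq_Icc h01).2] at hsub
  have haL : u.lo 0 ≤ u.lo 1 := (hsub (left_mem_Icc.2 hLR)).1
  have hRb : u.hi 1 ≤ u.hi 0 := (hsub (right_mem_Icc.2 hLR)).2
  have hfL : u.f (u.lo 1) = 1 := u.f_eq_one_iff.2 (left_mem_Icc.2 hLR)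
  have hfR : u.f (u.hi 1) = 1 := u.f_eq_one_iff.2 (right_mem_Icc.2 hLR)
  have h1 : ∀ x, u.f x ≤ 1 := fun x => (u.mem_Icc x).2
  have hlt : ∀ x, x ∉ Icc (u.lo 1) (u.hi 1) → u.f x < 1 := fun x hx =>
    lt_of_le_of_ne (h1 x) fun e => hx (u.f_eq_one_iff.1 e)
  have hP : 0 ≤ p * √(1 - u.f (u.lo 0)) := by positivity
  have hQ : 0 ≤ p * √(1 - u.f (u.hi 0)) := by positivity
  have hg0 : g 0 = 1 := by
    rw [hg, if_pos ⟨by linarith, hQ⟩]; simp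
  obtain ⟨hCl, hDl⟩ := supMin_parabola_regular (f := u.f) (g := g) (a := u.lo 0) (L := u.lo 1)
    u.mem_Icc (fun x _ y hy hxy => u.le_f_of_le_of_le (u.mem_Icc x).1 le_rfl
      ((h1 x).trans_eq hfL.symm) hxy hy) haL hfL (fun x hx => hlt x fun h => hx.not_ge h.1)
    (huC.mono (Icc_subset_Icc_right (hLR.trans hRb))) (fun x hx => huN x (.inl hx)) hp hQ hg
  obtain ⟨hCr, hDr⟩ := supMin_parabola_regular (f := fun x => u.f (-x)) (g := fun t => g (-t))
    (a := -u.hi 0) (L := -u.hi 1) (q := p * √(1 - u.f (u.lo 0))) (p := p)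
    (fun x => u.mem_Icc _)
    (fun x _ y hy hxy => u.le_f_of_le_of_le (u.mem_Icc _).1 ((h1 _).trans_eq hfR.symm)
      le_rfl (le_neg.1 hy) (neg_le_neg hxy))
    (neg_le_neg hRb) (by simpa using hfR)
    (fun x hx => hlt _ fun h => hx.not_ge (neg_le.1 h.2))
    (huC.comp continuousOn_neg fun x hx => ⟨by linarith [hx.2], by linarith [hx.1]⟩)
    (fun x hx => (huN (-x) (.inr ⟨by linarith [hx.2], by linarith [hx.1]⟩)).comp x
      differentiableAt_id.neg) hp hP
    (fun t => by
      rw [hg]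
      simp only [neg_neg, neg_le_neg_iff, neg_div, neg_sq]
      refine if_congr ?_ rfl rfl
      rw [and_comm, neg_le])
  simp only [neg_neg] at hCr hDr
  have hrefl : supMin (fun x => u.f (-x)) (fun t => g (-t)) = fun x => supMin u.f g (-x) :=
    funext (supMin_reflect u.f g)
  rw [hrefl] at hCr hDr
  have hCr' : ContinuousOn (supMin u.f g) (Icc (u.hi 1) (u.hi 0 + p * √(1 - u.f (u.hi 0)))) := by
    have := hCr.comp (continuousOn_neg (s := Icc (u.hi 1) (u.hi 0 + p * √(1 - u.f (u.hi 0)))))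
      fun x hx => ⟨by linarith [hx.2], by linarith [hx.1]⟩
    simpa [Function.comp_def] using this
  have hone : ∀ x ∈ Icc (u.lo 1) (u.hi 1), supMin u.f g x = 1 := fun x hx =>
    supMin_eq_one h1 hg0 (u.f_eq_one_iff.2 hx)
  refine ⟨?_, fun x hx => ?_⟩
  · have hCm : ContinuousOn (supMin u.f g) (Icc (u.lo 1) (u.hi 1)) :=
      continuousOn_const.congr hone
    rw [← Icc_union_Icc_eq_Icc (b := u.hi 1) (by linarith) (by linarith),
      ← Icc_union_Icc_eq_Icc (b := u.lo 1) (by linarith) hLR]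
    exact (hCl.union_of_isClosed hCm isClosed_Icc isClosed_Icc).union_of_isClosed hCr'
      (isClosed_Icc.union isClosed_Icc) isClosed_Icc
  · rcases lt_or_ge x (u.lo 1) with hxL | hxL
    · exact hDl x ⟨hx.1, hxL⟩
    rcases lt_or_ge (u.hi 1) x with hxR | hxR
    · have h2 := hDr (-x) ⟨by linarith [hx.2], by linarith⟩
      have h3 := DifferentiableAt.comp x h2 differentiableAt_id.neg
      simpa [Function.comp_def] using h3
    have hright : ∀ᶠ y in 𝓝 x, y ≤ u.hi 1 ∨ y - x ≤ p * √(1 - u.f (u.hi 0)) := by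
      rcases hxR.lt_or_eq with h | h
      · filter_upwards [Iic_mem_nhds h] with y hy using Or.inl hy
      · have hlt' : u.f (u.hi 0) < 1 := by
          refine lt_of_le_of_ne (h1 _) fun e => ?_
          have h2 := (u.f_eq_one_iff.1 e).2
          have h3 := hx.2
          simp only [e, sub_self, Real.sqrt_zero, mul_zero, add_zero] at h3
          linarith
        have hQ' : 0 < p * √(1 - u.f (u.hi 0)) := mul_pos hp (Real.sqrt_pos.2 (by linarith))
        filter_upwards [Iic_mem_nhds (lt_add_of_pos_right x hQ')] with y hy
        exact Or.inr (by linarith [mem_Iic.1 hy])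
    have hleft : ∀ᶠ y in 𝓝 x, u.lo 1 ≤ y ∨ -(p * √(1 - u.f (u.lo 0))) ≤ y - x := by
      rcases hxL.lt_or_eq with h | h
      · filter_upwards [Ici_mem_nhds h] with y hy using Or.inl hy
      · have hlt' : u.f (u.lo 0) < 1 := by
          refine lt_of_le_of_ne (h1 _) fun e => ?_
          have h2 := (u.f_eq_one_iff.1 e).1
          have h3 := hx.1
          simp only [e, sub_self, Real.sqrt_zero, mul_zero, sub_zero] at h3
          linarith
        have hP' : 0 < p * √(1 - u.f (u.lo 0)) := mul_pos hp (Real.sqrt_pos.2 (by linarith))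
        filter_upwards [Ici_mem_nhds (sub_lt_self x hP')] with y hy
        exact Or.inr (by linarith [mem_Ici.1 hy])
    refine differentiableAt_of_parabola_le (p := p) ?_ (supMin_le_one h1)
    filter_upwards [hright, hleft] with y hyr hyl
    have hsq := sq_nonneg ((y - x) / p)
    by_cases hy : y ∈ Icc (u.lo 1) (u.hi 1)
    · rw [hone y hy]
      linarith
    · have hin : -(p * √(1 - u.f (u.lo 0))) ≤ y - x ∧ y - x ≤ p * √(1 - u.f (u.hi 0)) := by
        rcases le_total y x with hyx | hyx
        · exact ⟨hyl.resolve_left fun h => hy ⟨h, hyx.trans hxR⟩, by linarith⟩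
        · exact ⟨by linarith, hyr.resolve_left fun h => hy ⟨hxL.trans hyx, h⟩⟩
      have h2 := min_le_supMin (g := g) h1 y x
      rw [u.f_eq_one_iff.2 ⟨hxL, hxR⟩, hg, if_pos hin, min_eq_right (by linarith)] at h2
      exact h2

end FuzzyNumber

/-- Theorem `nct`: for `u ∈ F_N(ℝ) ∩ F_C(ℝ)` with
`l = u(u⁻(0))`, `r = u(u⁺(0))`, and the fuzzy numbers `v_p` given by
`v_p(t) = 1 - (t/p)²` on `[-p√(1-l), p√(1-r)]` and `0` elsewhere, every
`u∇v_{1/n}` (`n ≥ 1`) is in `F_D(ℝ)` with `d_∞(u∇v_{1/n}, u) ≤ 1/n`; in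
particular the sequence converges to `u` in the supremum metric. -/
theorem conv_smooth_approximation (u : FuzzyNumber) (l r : ℝ)
    (hl : u.f (u.lo 0) = l) (hr : u.f (u.hi 0) = r)
    -- `u ∈ F_C(ℝ)`
    (huC : ContinuousOn u.f (Set.Icc (u.lo 0) (u.hi 0)))
    -- `u ∈ F_N(ℝ)`
    (huN : ∀ x ∈ Set.Ioo (u.lo 0) (u.lo 1) ∪ Set.Ioo (u.hi 1) (u.hi 0),
      DifferentiableAt ℝ u.f x)
    -- the family of smoothers `v_p`, `p > 0`
    (v : ℝ → FuzzyNumber)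
    (hv : ∀ p : ℝ, 0 < p → ∀ t : ℝ, (v p).f t =
      if -(p * Real.sqrt (1 - l)) ≤ t ∧ t ≤ p * Real.sqrt (1 - r)
      then 1 - (t / p) ^ 2 else 0) :
    (∀ n : ℕ, 1 ≤ n →
      -- `u∇v_{1/n} ∈ F_D(ℝ)`
      (ContinuousOn (u.conv (v (1 / (n : ℝ))))
          (Set.Icc (u.lo 0 + (v (1 / (n : ℝ))).lo 0)
            (u.hi 0 + (v (1 / (n : ℝ))).hi 0)) ∧
        ∀ x ∈ Set.Ioo (u.lo 0 + (v (1 / (n : ℝ))).lo 0)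
            (u.hi 0 + (v (1 / (n : ℝ))).hi 0),
          DifferentiableAt ℝ (u.conv (v (1 / (n : ℝ)))) x) ∧
      -- `d_∞(u∇v_{1/n}, u) ≤ 1/n`
      (⨆ α : Set.Icc (0 : ℝ) 1,
        max |(u.lo ↑α + (v (1 / (n : ℝ))).lo ↑α) - u.lo ↑α|
            |(u.hi ↑α + (v (1 / (n : ℝ))).hi ↑α) - u.hi ↑α|) ≤ 1 / (n : ℝ)) ∧
    -- convergence in the supremum metric
    Filter.Tendsto (fun n : ℕ =>
      ⨆ α : Set.Icc (0 : ℝ) 1,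
        max |(u.lo ↑α + (v (1 / (n : ℝ))).lo ↑α) - u.lo ↑α|
            |(u.hi ↑α + (v (1 / (n : ℝ))).hi ↑α) - u.hi ↑α|)
      Filter.atTop (nhds 0) := by
  subst hl hr
  have hsqrt : ∀ x, √(1 - u.f x) ≤ 1 := fun x =>
    Real.sqrt_le_iff.2 ⟨zero_le_one, by linarith [(u.mem_Icc x).1]⟩
  have hvb : ∀ p : ℝ, 0 < p → ∀ α ∈ Icc (0 : ℝ) 1,
      -(p * √(1 - u.f (u.lo 0))) ≤ (v p).lo α ∧ (v p).lo α ≤ (v p).hi α ∧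
        (v p).hi α ≤ p * √(1 - u.f (u.hi 0)) := fun p hp α hα =>
    (v p).lo_hi_bounds (fun t ht => (hv p hp t).trans (if_neg ht)) hα
  have hdist : ∀ n : ℕ, 1 ≤ n → (⨆ α : Set.Icc (0 : ℝ) 1,
        max |(u.lo ↑α + (v (1 / (n : ℝ))).lo ↑α) - u.lo ↑α|
            |(u.hi ↑α + (v (1 / (n : ℝ))).hi ↑α) - u.hi ↑α|) ≤ 1 / (n : ℝ) := by
    intro n hn
    have hp : (0 : ℝ) < 1 / (n : ℝ) := by positivity
    have : Nonempty (Icc (0 : ℝ) 1) := ⟨⟨0, le_rfl, zero_le_one⟩⟩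
    refine ciSup_le fun α => ?_
    obtain ⟨h1, h2, h3⟩ := hvb _ hp α α.2
    have h4 := mul_le_of_le_one_right hp.le (hsqrt (u.lo 0))
    have h5 := mul_le_of_le_one_right hp.le (hsqrt (u.hi 0))
    rw [add_sub_cancel_left, add_sub_cancel_left]
    refine max_le (abs_le.2 ⟨?_, ?_⟩) (abs_le.2 ⟨?_, ?_⟩) <;> linarith
  refine ⟨fun n hn => ⟨?_, hdist n hn⟩, ?_⟩
  · have hp : (0 : ℝ) < 1 / (n : ℝ) := by positivity
    obtain ⟨hC, hD⟩ := u.supMin_parabola_smooth huC huN hp (hv _ hp)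
    obtain ⟨h1, -, h3⟩ := hvb _ hp 0 ⟨le_rfl, zero_le_one⟩
    have hA : u.lo 0 - 1 / (n : ℝ) * √(1 - u.f (u.lo 0)) ≤ u.lo 0 + (v (1 / (n : ℝ))).lo 0 := by
      linarith
    have hB : u.hi 0 + (v (1 / (n : ℝ))).hi 0 ≤ u.hi 0 + 1 / (n : ℝ) * √(1 - u.f (u.hi 0)) := by
      linarith
    exact ⟨hC.mono (Icc_subset_Icc hA hB), fun x hx => hD x (Ioo_subset_Ioo hA hB hx)⟩
  · refine squeeze_zero' (.of_forall fun n => Real.iSup_nonneg fun α => ?_)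
      (eventually_atTop.2 ⟨1, hdist⟩) tendsto_one_div_atTop_nhds_zero_nat
    exact (abs_nonneg _).trans (le_max_left _ _)
end
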